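/- Let i range over a finite index set with weights w_i ≥ 0, failure indicators Δ_i ∈ {0,1}, observed times T_i ∈ ℝ, relative risks r_i > 0, and covariates Z_i ∈ ℝ. Define Ŝ⁰(t) = Σ_i w_i·r_i·1{T_i ≥ t} and Ŝ¹(t) = Σ_i w_i·Z_i·r_i·1{T_i ≥ t}, and assume Ŝ⁰(T_k) > 0 for every k with w_k·Δ_k > 0. Let Λ̂(t) = Σ_k w_k·Δ_k·1{T_k ≤ t}/Ŝ⁰(T_k). Then Σ_i w_i·[Δ_i·Z_i − Z_i·r_i·Λ̂(T_i)] = Σ_i w_i·Δ_i·[Z_i − Ŝ¹(T_i)/Ŝ⁰(T_i)]; that is, substituting the IPW Breslow estimator Λ̂_β into the IPW likelihood score for β yields exactly the inverse probability weighted Cox partial likelihood score equation. -/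

import Mathlib

/-- **Substituting the IPW Breslow estimator into the IPW likelihood score for β
yields the inverse probability weighted Cox partial likelihood score equation.**
With weights `w i ≥ 0`, failure indicators `Δ i ∈ {0,1}`, observed times `T i`,
relative risks `r i = exp(Z i β) > 0`, covariates `Z i`, IPW at-risk sums
`Ŝ⁰(t) = Σ_i w i r i 1{T i ≥ t}` and `Ŝ¹(t) = Σ_i w i Z i r i 1{T i ≥ t}`
(with `Ŝ⁰(T k) > 0` whenever `w k Δ k > 0`), and the IPW Breslow estimator
`Λ̂(t) = Σ_k w k Δ k 1{T k ≤ t}/Ŝ⁰(T k)`, one has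
`Σ_i w i [Δ i Z i − Z i r i Λ̂(T i)] = Σ_i w i Δ i [Z i − Ŝ¹(T i)/Ŝ⁰(T i)]`. -/
theorem stmt13 {ι : Type*} [Fintype ι]
    (w Δ T r Z : ι → ℝ)
    (hw : ∀ i, 0 ≤ w i)
    (hΔ : ∀ i, Δ i = 0 ∨ Δ i = 1)
    (hr : ∀ i, 0 < r i)
    (S0 S1 : ℝ → ℝ)
    (hS0 : ∀ t, S0 t = ∑ i, w i * r i * (if t ≤ T i then (1:ℝ) else 0))
    (hS1 : ∀ t, S1 t = ∑ i, w i * Z i * r i * (if t ≤ T i then (1:ℝ) else 0))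
    (hpos : ∀ k, 0 < w k * Δ k → 0 < S0 (T k))
    (Λ : ℝ → ℝ)
    (hΛ : ∀ t, Λ t = ∑ k, w k * Δ k * (if T k ≤ t then (1:ℝ) else 0) / S0 (T k)) :
    ∑ i, w i * (Δ i * Z i - Z i * r i * Λ (T i))
      = ∑ i, w i * Δ i * (Z i - S1 (T i) / S0 (T i)) := by
  have key : ∑ i, w i * Z i * r i * Λ (T i) = ∑ k, w k * Δ k * (S1 (T k) / S0 (T k)) := by
    simp only [hΛ, hS1, Finset.mul_sum, Finset.sum_div]
    rw [Finset.sum_comm]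
    refine Finset.sum_congr rfl fun k _ => Finset.sum_congr rfl fun i _ => ?_
    ring
  have h1 : ∑ i, w i * (Δ i * Z i - Z i * r i * Λ (T i))
      = ∑ i, w i * Δ i * Z i - ∑ i, w i * Z i * r i * Λ (T i) := by
    rw [← Finset.sum_sub_distrib]
    exact Finset.sum_congr rfl fun i _ => by ring
  rw [h1, key, ← Finset.sum_sub_distrib]
  exact Finset.sum_congr rfl fun i _ => by ring
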